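/- arXiv:2106.14673 — 3 statements merged into one kernel-verified Lean document; each statement's English description precedes it below -/
import Mathlib

section
/- Assume X_η = X_B, i.e. the B-free subshift coincides with the B-admissible subshift. Let τ : X_η → X_η be a surjective cellular automaton given by a code of radius ℓ. Then there exists t ∈ {−ℓ, …, ℓ} with τ = S^t. In particular, (X_η, S) satisfies the Moore property: every surjective CA on (X_η, S) is pre-injective. -/
open Filter Set

noncomputable section

/-- The shift by `t`: `(shiftPow t x) n = x (n + t)`, i.e. `S^t`. -/
def shiftPow (t : ℤ) (x : ℤ → Bool) : ℤ → Bool := fun n => x (n + t)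

/-- The left shift `S`, `(S x) n = x (n + 1)`. -/
def shift : (ℤ → Bool) → (ℤ → Bool) := shiftPow 1

/-- The support of a `0-1`-sequence. -/
def supp (x : ℤ → Bool) : Set ℤ := {n | x n = true}

/-- The all-zero sequence `0^ℤ`. -/
def zeroSeq : ℤ → Bool := fun _ => false

/-- The all-one sequence `1^ℤ`. -/
def oneSeq : ℤ → Bool := fun _ => true

/-- The sequence `u = 0^{-ℕ} 1 0^{ℕ}` with a single `1` at position `0`. -/
def uSeq : ℤ → Bool := fun n => if n = 0 then true else false

/-- The set `F_B ⊆ ℤ` of `B`-free integers. -/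
def BFreeSet (B : Set ℕ) : Set ℤ := {n | ∀ b ∈ B, ¬ ((b : ℤ) ∣ n)}

open Classical in
/-- `η`, the indicator function of the `B`-free integers. -/
noncomputable def eta (B : Set ℕ) : ℤ → Bool := fun n => if n ∈ BFreeSet B then true else false

/-- The `B`-free subshift `X_η`: the orbit closure of `η` under the shift. -/
def Xeta (B : Set ℕ) : Set (ℤ → Bool) := closure {x | ∃ t : ℤ, x = shiftPow t (eta B)}

/-- A set `A ⊆ ℤ` is `B`-admissible if for every `b ∈ B` some residue class
mod `b` is disjoint from `A`. -/
def IsBAdmissible (B : Set ℕ) (A : Set ℤ) : Prop :=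
  ∀ b ∈ B, ∃ r : ℤ, ∀ a ∈ A, ¬ ((b : ℤ) ∣ (a - r))

/-- The `B`-admissible subshift `X_B`. -/
def XB (B : Set ℕ) : Set (ℤ → Bool) := {x | IsBAdmissible B (supp x)}

/-- `B` is primitive: no element divides a different element. -/
def Primitive (B : Set ℕ) : Prop := ∀ a ∈ B, ∀ b ∈ B, a ∣ b → a = b

/-- `B` is an Erdős set: infinite, `1 ∉ B` (elements positive), primitive, pairwise
coprime and thin. -/
def IsErdos (B : Set ℕ) : Prop :=
  B.Infinite ∧ (∀ b ∈ B, 2 ≤ b) ∧ Primitive B ∧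
    (∀ a ∈ B, ∀ b ∈ B, a ≠ b → Nat.Coprime a b) ∧
    Summable (fun b : B => (1 : ℝ) / (b : ℝ))

/-- A cellular automaton on `X`: a continuous self-map of `X` commuting with the shift. -/
def IsCA (X : Set (ℤ → Bool)) (τ : (ℤ → Bool) → (ℤ → Bool)) : Prop :=
  Set.MapsTo τ X X ∧ ContinuousOn τ X ∧ ∀ x ∈ X, τ (shift x) = shift (τ x)

/-- Pre-injectivity of a CA on `X`. -/
def PreInjective (X : Set (ℤ → Bool)) (τ : (ℤ → Bool) → (ℤ → Bool)) : Prop :=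
  ∀ x ∈ X, ∀ y ∈ X, τ x = τ y → {n : ℤ | x n ≠ y n}.Finite → x = y

/-- `X` is hereditary. -/
def Hereditary (X : Set (ℤ → Bool)) : Prop :=
  ∀ x ∈ X, ∀ y : ℤ → Bool, (∀ n, y n ≤ x n) → y ∈ X

/-- The hereditary closure `X̃` of a set `X`. -/
def heredClosure (X : Set (ℤ → Bool)) : Set (ℤ → Bool) :=
  {y | ∃ x ∈ X, ∀ n, y n ≤ x n}

/-- `X` is a subshift: nonempty, closed and shift-invariant. -/
def IsSubshift (X : Set (ℤ → Bool)) : Prop :=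
  X.Nonempty ∧ IsClosed X ∧ shift '' X = X

/-- `τ` is given by a (sliding block) code of radius `ℓ` on `X`. -/
def HasRadius (X : Set (ℤ → Bool)) (τ : (ℤ → Bool) → (ℤ → Bool)) (ℓ : ℕ) : Prop :=
  ∀ x ∈ X, ∀ y ∈ X, ∀ n : ℤ,
    (∀ i : ℤ, n - ℓ ≤ i → i ≤ n + ℓ → x i = y i) → τ x n = τ y n

open Classical in
/-- `A ⊆ ℤ` has logarithmic density `d`. -/
noncomputable def HasLogDensity (A : Set ℤ) (d : ℝ) : Prop :=
  Tendsto (fun N : ℕ =>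
      (Real.log N)⁻¹ * ∑ n ∈ Finset.Icc 1 N, (if (n : ℤ) ∈ A then (1 : ℝ) / (n : ℝ) else 0))
    atTop (nhds d)

/-- `B` is taut: removing any `b ∈ B` strictly increases the logarithmic density of the
`B`-free integers. -/
def IsTaut (B : Set ℕ) : Prop :=
  ∀ b ∈ B, ∀ d d' : ℝ,
    HasLogDensity (BFreeSet B) d → HasLogDensity (BFreeSet (B \ {b})) d' → d < d'

/-- `x` and `y` are proximal: along some sequence `r k → ∞`, the shifted sequences
`S^{r k} x` and `S^{r k} y` agree on arbitrarily large central windows, i.e.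
`d(S^{r k} x, S^{r k} y) → 0` in the product topology. -/
def ProximalPair (x y : ℤ → Bool) : Prop :=
  ∃ r : ℕ → ℤ, Tendsto r atTop atTop ∧
    ∀ m : ℕ, ∀ᶠ k in atTop, ∀ n : ℤ, |n| ≤ (m : ℤ) →
      shiftPow (r k) x n = shiftPow (r k) y n

/-- A subshift is proximal if every pair of its points is proximal. -/
def IsProximalSubshift (X : Set (ℤ → Bool)) : Prop :=
  ∀ x ∈ X, ∀ y ∈ X, ProximalPair x y

end

theorem exists_int_gt_modEq {T : Finset ℕ} (hpos : ∀ b ∈ T, 2 ≤ b)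
    (hco : (T : Set ℕ).Pairwise Nat.Coprime) (v : ℕ → ℤ) (K : ℤ) :
    ∃ m : ℤ, K < m ∧ ∀ b ∈ T, (b : ℤ) ∣ m - v b := by
  obtain ⟨k, hk⟩ := Nat.chineseRemainderOfFinset (fun b => (v b % (b : ℤ)).toNat) id T
    (fun b hb => by have := hpos b hb; simp only [id]; omega) hco
  have hP : 0 < ∏ b ∈ T, b := Finset.prod_pos fun b hb => by have := hpos b hb; omega
  refine ⟨k + (K.toNat + 1 : ℕ) * ((∏ b ∈ T, b : ℕ) : ℤ), ?_, fun b hb => ?_⟩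
  · have : ((K.toNat + 1 : ℕ) : ℤ) * 1 ≤ (K.toNat + 1 : ℕ) * ((∏ b ∈ T, b : ℕ) : ℤ) :=
      mul_le_mul_of_nonneg_left (by exact_mod_cast hP) (by positivity)
    omega
  · have h1 : (b : ℤ) ∣ ((∏ b ∈ T, b : ℕ) : ℤ) := by
      exact_mod_cast Finset.dvd_prod_of_mem (fun b => b) hb
    have hb0 : (b : ℤ) ≠ 0 := by have := hpos b hb; omega
    have h2 : (b : ℤ) ∣ (k : ℤ) - v b := by
      have h3 := (Int.natCast_modEq_iff.mpr (hk b hb)).dvd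
      simp only [id, Int.toNat_of_nonneg (Int.emod_nonneg (v b) hb0)] at h3
      have h4 := Int.emod_add_mul_ediv (v b) b
      have h5 := (dvd_neg.mpr h3).sub (Dvd.intro (v b / b) rfl)
      rwa [show -(v b % (b : ℤ) - k) - b * (v b / b) = k - v b by linarith] at h5
    have := h2.add (h1.mul_left ((K.toNat + 1 : ℕ) : ℤ))
    rwa [show (k : ℤ) - v b + (K.toNat + 1 : ℕ) * ((∏ b ∈ T, b : ℕ) : ℤ) =
      k + (K.toNat + 1 : ℕ) * ((∏ b ∈ T, b : ℕ) : ℤ) - v b by ring] at this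

theorem exists_missing_residue {A : Finset ℤ} {c : ℕ} (h : A.card < c) :
    ∃ r : ℤ, ∀ a ∈ A, ¬ (c : ℤ) ∣ a - r := by
  by_contra! H
  have hc : (0 : ℤ) < c := by omega
  have hsub : Finset.range c ⊆ A.image fun a => (a % (c : ℤ)).toNat := by
    intro r hr
    obtain ⟨a, ha, hd⟩ := H r
    refine Finset.mem_image.2 ⟨a, ha, ?_⟩
    have h1 : (r : ℤ) % c = a % c := Int.modEq_iff_dvd.2 hd
    rw [Int.emod_eq_of_lt (by positivity) (by exact_mod_cast Finset.mem_range.1 hr)] at h1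
    simp [← h1]
  have := (Finset.card_le_card hsub).trans Finset.card_image_le
  simp at this
  omega

/-- The indicator sequence of a finite set of integers. -/
def finIndicator (A : Finset ℤ) : ℤ → Bool := fun n => decide (n ∈ A)

theorem supp_finIndicator (A : Finset ℤ) : supp (finIndicator A) = A := by
  ext n; simp [supp, finIndicator]

theorem IsBAdmissible.mono {B : Set ℕ} {A A' : Set ℤ} (h : IsBAdmissible B A) (hs : A' ⊆ A) :
    IsBAdmissible B A' := fun b hb =>
  (h b hb).imp fun _ hr a ha => hr a (hs ha)

theorem shiftPow_mem_XB {B : Set ℕ} {x : ℤ → Bool} (hx : x ∈ XB B) (t : ℤ) :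
    shiftPow t x ∈ XB B := fun b hb => by
  obtain ⟨r, hr⟩ := hx b hb
  refine ⟨r - t, fun a ha => ?_⟩
  have := hr (a + t) ha
  rwa [show a - (r - t) = a + t - r by ring]

theorem shiftPow_shiftPow (s t : ℤ) (x : ℤ → Bool) :
    shiftPow s (shiftPow t x) = shiftPow (s + t) x := by
  funext n; simp [shiftPow, add_assoc]

theorem shiftPow_zero (x : ℤ → Bool) : shiftPow 0 x = x := by
  funext n; simp [shiftPow]

theorem IsCA.shiftPow_comm {B : Set ℕ} {τ : (ℤ → Bool) → (ℤ → Bool)} (hτ : IsCA (XB B) τ)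
    {x : ℤ → Bool} (hx : x ∈ XB B) (n : ℤ) : τ (shiftPow n x) = shiftPow n (τ x) := by
  induction n using Int.induction_on with
  | zero => simp [shiftPow_zero]
  | succ n ih =>
    rw [add_comm, ← shiftPow_shiftPow, ← shiftPow_shiftPow 1, ← ih]
    exact hτ.2.2 _ (shiftPow_mem_XB hx _)
  | pred n ih =>
    have h := hτ.2.2 _ (shiftPow_mem_XB hx (-(n : ℤ) - 1))
    rw [shift, shiftPow_shiftPow, show 1 + (-(n : ℤ) - 1) = -n by ring, ih] at h
    have h' := congrArg (shiftPow (-1)) h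
    simp only [shiftPow_shiftPow] at h'
    rw [show -1 + (1 : ℤ) = 0 by ring, shiftPow_zero, show -1 + (-(n : ℤ)) = -n - 1 by ring] at h'
    exact h'.symm

/-- Two finite admissible sets can be placed far apart, with prescribed residues of the
translation modulo finitely many elements of `B`, so that the union is still admissible. -/
theorem exists_admissible_union {B : Set ℕ} (hB : ∀ b ∈ B, 2 ≤ b)
    (hco : B.Pairwise Nat.Coprime) {A W : Finset ℤ} (hA : IsBAdmissible B A)
    (hW : IsBAdmissible B W) {C : Finset ℕ} (hC : (C : Set ℕ) ⊆ B) (γ v : ℕ → ℤ)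
    (hAγ : ∀ b ∈ C, ∀ a ∈ A, ¬ (b : ℤ) ∣ a - γ b)
    (hWγ : ∀ b ∈ C, ∀ a ∈ W, ¬ (b : ℤ) ∣ a + v b - γ b) (K : ℤ) :
    ∃ m : ℤ, K < m ∧ (∀ b ∈ C, (b : ℤ) ∣ m - v b) ∧
      IsBAdmissible B (A ∪ W.image (· + m) : Finset ℤ) := by
  classical
  choose! c hc using hA
  choose! d hd using hW
  set M := A.card + W.card with hM
  set T : Finset ℕ := C ∪ (Finset.range (M + 1)).filter (· ∈ B) with hT
  have hTB : (T : Set ℕ) ⊆ B := by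
    intro b hb
    simp only [hT, Finset.coe_union, Set.mem_union, Finset.mem_coe, Finset.mem_filter] at hb
    exact hb.elim (fun h => hC h) fun h => h.2
  obtain ⟨m, hKm, hm⟩ := exists_int_gt_modEq (fun b hb => hB b (hTB hb)) (hco.mono hTB)
    (fun b => if b ∈ C then v b else c b - d b) K
  refine ⟨m, hKm, fun b hb => ?_, fun b hb => ?_⟩
  · have := hm b (Finset.mem_union_left _ hb)
    rwa [if_pos hb] at this
  by_cases hbC : b ∈ C
  · have h := hm b (Finset.mem_union_left _ hbC)
    rw [if_pos hbC] at h
    refine ⟨γ b, fun a ha => ?_⟩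
    rcases Finset.mem_union.1 (Finset.mem_coe.1 ha) with ha | ha
    · exact hAγ b hbC a ha
    · obtain ⟨w, hw, rfl⟩ := Finset.mem_image.1 ha
      intro h'
      refine hWγ b hbC w hw ?_
      rw [show w + v b - γ b = w + m - γ b - (m - v b) by ring]
      exact h'.sub h
  by_cases hbM : b ≤ M
  · have h := hm b (Finset.mem_union_right _ (Finset.mem_filter.2
      ⟨Finset.mem_range.2 (by omega), hb⟩))
    rw [if_neg hbC] at h
    refine ⟨c b, fun a ha => ?_⟩
    rcases Finset.mem_union.1 (Finset.mem_coe.1 ha) with ha | ha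
    · exact hc b hb a ha
    · obtain ⟨w, hw, rfl⟩ := Finset.mem_image.1 ha
      intro h'
      refine hd b hb w hw ?_
      rw [show w - d b = w + m - c b - (m - (c b - d b)) by ring]
      exact h'.sub h
  · refine exists_missing_residue (lt_of_le_of_lt (Finset.card_union_le _ _) ?_)
    have := Finset.card_image_le (s := W) (f := (· + m))
    omega

theorem exists_shift_eta_eq {B : Set ℕ} {x : ℤ → Bool} (hx : x ∈ Xeta B) (F : Finset ℤ) :
    ∃ t : ℤ, ∀ i ∈ F, eta B (i + t) = x i := by
  have hopen : IsOpen (Set.pi (F : Set ℤ) fun i => ({x i} : Set Bool)) :=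
    isOpen_set_pi F.finite_toSet fun _ _ => isOpen_discrete _
  obtain ⟨y, hy, t, rfl⟩ := mem_closure_iff.1 hx _ hopen (by simp [Set.mem_pi])
  exact ⟨t, fun i hi => hy i hi⟩

theorem not_dvd_of_eta_eq_true {B : Set ℕ} {n : ℤ} (h : eta B n = true) :
    ∀ b ∈ B, ¬ (b : ℤ) ∣ n := by
  by_contra h'
  have : n ∉ BFreeSet B := h'
  simp [eta, this] at h

theorem isBAdmissible_of_card_le_one {B : Set ℕ} (hB : ∀ b ∈ B, 2 ≤ b) {A : Finset ℤ}
    (hA : A.card ≤ 1) : IsBAdmissible B A :=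
  fun b hb => exists_missing_residue (by have := hB b hb; omega)

theorem finIndicator_mem_XB {B : Set ℕ} {A : Finset ℤ} (h : IsBAdmissible B A) :
    finIndicator A ∈ XB B := by
  rw [← supp_finIndicator] at h
  exact h

theorem infinite_of_Xeta_eq_XB {B : Set ℕ} (hB : ∀ b ∈ B, 2 ≤ b) (heq : Xeta B = XB B) :
    B.Infinite := by
  intro hfin
  set L : ℕ := ∏ b ∈ hfin.toFinset, b with hL
  have hL0 : 0 < L := Finset.prod_pos fun b hb => by
    have := hB b (hfin.mem_toFinset.1 hb); omega
  have hmem : finIndicator {0} ∈ Xeta B := heq ▸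
    finIndicator_mem_XB (isBAdmissible_of_card_le_one hB (by simp))
  obtain ⟨t, ht⟩ := exists_shift_eta_eq hmem {0, (L : ℤ)}
  have h0 := ht 0 (by simp)
  have h1 := ht L (by simp)
  have hL0' : (L : ℤ) ≠ 0 := by omega
  simp only [finIndicator, Finset.mem_singleton, hL0', decide_true, decide_false, zero_add]
    at h0 h1
  have : (L : ℤ) + t ∈ BFreeSet B := fun b hb hd => by
    refine not_dvd_of_eta_eq_true h0 b hb ((Int.dvd_add_right ?_).1 hd)
    exact_mod_cast Finset.dvd_prod_of_mem (fun b => b) (hfin.mem_toFinset.2 hb)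
  simp [eta, this] at h1

theorem exists_prime_mul_congr {a : ℕ} (ha : a ≠ 0) (α : ℤ) (M : ℕ) :
    ∃ p g : ℕ, p.Prime ∧ M < p ∧ g ∣ a ∧ (g : ℤ) ∣ α ∧ (a : ℤ) ∣ g * p - α := by
  have hg0 : 0 < Int.gcd α a := Int.gcd_pos_of_ne_zero_right _ (by exact_mod_cast ha)
  set g := Int.gcd α a with hg
  obtain ⟨u, hu⟩ : (g : ℤ) ∣ α := Int.gcd_dvd_left ..
  obtain ⟨q, hq⟩ : g ∣ a := by exact_mod_cast (Int.gcd_dvd_right α a)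
  have hq0 : q ≠ 0 := fun h => ha (by rw [hq, h, mul_zero])
  have hcop : IsCoprime u (q : ℤ) := by
    rw [Int.isCoprime_iff_gcd_eq_one]
    have h1 : Int.gcd (g * u) (g * q) = g * Int.gcd u q := by
      simp [Int.gcd_mul_left]
    rw [← hu, show (g : ℤ) * q = a by rw [hq]; push_cast; ring, ← hg] at h1
    exact (Nat.mul_left_cancel hg0 (by rw [mul_one]; exact h1)).symm
  obtain ⟨p, hMp, hp, hmod⟩ := Nat.forall_exists_prime_gt_and_zmodEq M hq0 hcop
  refine ⟨p, g, hp, hMp, ⟨q, hq⟩, ⟨u, hu⟩, ?_⟩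
  rw [show (a : ℤ) = g * q by rw [hq]; push_cast; ring,
    show (g : ℤ) * p - α = g * (p - u) by rw [mul_sub, ← hu]]
  exact mul_dvd_mul_left _ hmod.symm.dvd

theorem gcd_dvd_of_divisor {B : Set ℕ} (hB : ∀ b ∈ B, 2 ≤ b) (hprim : Primitive B)
    (heq : Xeta B = XB B) {a b e : ℕ} (ha : a ∈ B) (hb : b ∈ B) (hab : a ≠ b)
    (heb : e ∣ b) (hea : ¬ e ∣ a) : Nat.gcd a b ∣ e := by
  by_contra hde
  have ha2 := hB a ha
  have hb2 := hB b hb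
  have he : e < b := lt_of_le_of_ne (Nat.le_of_dvd (by omega) heb) fun h =>
    hde (h ▸ Nat.gcd_dvd_right a b)
  choose p g hp hpM hga hgα hmod using fun α : ℤ =>
    exists_prime_mul_congr (a := a) (by omega) α (a + b)
  choose p' g' hp' hpM' hgb' hgα' hmod' using fun α : ℤ =>
    exists_prime_mul_congr (a := b) (by omega) α (a + b)
  set A₁ : Finset ℤ := ((Finset.range a).erase 0).image fun α : ℕ => (g α * p α : ℤ) with hA₁
  set A₂ : Finset ℤ := ((Finset.range b).erase e).image fun α : ℕ => (g' α * p' α : ℤ) with hA₂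
  have hcop : ∀ {c q : ℕ}, c ∈ B → c ≤ a + b → q.Prime → a + b < q → Nat.Coprime c q :=
    fun {c q} hc hcM hq hqM => ((Nat.Prime.coprime_iff_not_dvd hq).2 fun h => by
      have := Nat.le_of_dvd (by have := hB c hc; omega) h
      omega).symm
  have hadm : IsBAdmissible B (A₁ ∪ A₂ : Finset ℤ) := by
    intro c hc
    by_cases hcM : c ≤ a + b
    swap
    · refine exists_missing_residue ?_
      have h1 : A₁.card ≤ a := Finset.card_image_le.trans (by
        simpa using Finset.card_erase_le (s := Finset.range a) (a := 0))
      have h2 : A₂.card ≤ b := Finset.card_image_le.trans (by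
        simpa using Finset.card_erase_le (s := Finset.range b) (a := e))
      have := Finset.card_union_le A₁ A₂
      omega
    by_cases hcb : c = b
    · subst hcb
      refine ⟨e, fun n hn hd => ?_⟩
      rcases Finset.mem_union.1 (Finset.mem_coe.1 hn) with hn | hn
      · obtain ⟨α, hα, rfl⟩ := Finset.mem_image.1 hn
        have h1 : (e : ℤ) ∣ g α * p α := by
          have := (Int.natCast_dvd_natCast.2 heb).trans hd
          exact (dvd_sub_left (dvd_refl _)).1 this
        have h2 : e ∣ g α * p α := by exact_mod_cast h1
        exact hea ((((hcop hc hcM (hp α) (hpM α)).coprime_dvd_left heb).dvd_of_dvd_mul_right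
          h2).trans (hga α))
      · obtain ⟨α, hα, rfl⟩ := Finset.mem_image.1 hn
        have h1 := hd.sub (hmod' α)
        simp only [sub_sub_sub_cancel_left] at h1
        have hα' := Finset.mem_erase.1 hα
        have hlt := Finset.mem_range.1 hα'.2
        have h2 := Int.eq_zero_of_abs_lt_dvd h1 (by rw [abs_lt]; omega)
        omega
    · refine ⟨0, fun n hn hd => ?_⟩
      rw [sub_zero] at hd
      rcases Finset.mem_union.1 (Finset.mem_coe.1 hn) with hn | hn
      · obtain ⟨α, hα, rfl⟩ := Finset.mem_image.1 hn
        have h2 : c ∣ g α * p α := by exact_mod_cast hd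
        have h3 := (hcop hc hcM (hp α) (hpM α)).dvd_of_dvd_mul_right h2
        have h4 := hprim c hc a ha (h3.trans (hga α))
        have h5 : c ∣ α := h3.trans (by exact_mod_cast hgα α)
        have hα' := Finset.mem_erase.1 hα
        have hlt := Finset.mem_range.1 hα'.2
        have := Nat.le_of_dvd (by omega) h5
        omega
      · obtain ⟨α, hα, rfl⟩ := Finset.mem_image.1 hn
        have h2 : c ∣ g' α * p' α := by exact_mod_cast hd
        have h3 := (hcop hc hcM (hp' α) (hpM' α)).dvd_of_dvd_mul_right h2
        exact hcb (hprim c hc b hb (h3.trans (hgb' α)))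
  obtain ⟨t, ht⟩ := exists_shift_eta_eq (heq ▸ finIndicator_mem_XB hadm) (A₁ ∪ A₂)
  replace ht : ∀ n ∈ A₁ ∪ A₂, ∀ c ∈ B, ¬ (c : ℤ) ∣ n + t := fun n hn =>
    not_dvd_of_eta_eq_true ((ht n hn).trans (by simpa [finIndicator] using hn))
  have key : ∀ c : ℕ, 2 ≤ c → ∃ α : ℕ, α < c ∧ (c : ℤ) ∣ α + t := fun c hc => by
    have h0 := Int.emod_nonneg (-t) (b := (c : ℤ)) (by omega)
    have h1 := Int.emod_lt_of_pos (-t) (b := (c : ℤ)) (by omega)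
    refine ⟨(-t % c).toNat, by omega, ?_⟩
    rw [Int.toNat_of_nonneg h0, show -t % c + t = -(-t - -t % c) by ring]
    exact (Int.dvd_self_sub_emod).neg_right
  obtain ⟨α, hα, hαt⟩ := key a ha2
  obtain ⟨β, hβ, hβt⟩ := key b hb2
  have hα0 : α = 0 := by
    by_contra h
    refine ht _ (Finset.mem_union_left _ (Finset.mem_image_of_mem _
      (Finset.mem_erase.2 ⟨h, Finset.mem_range.2 hα⟩))) a ha ?_
    rw [show (g α * p α + t : ℤ) = g α * p α - α + (α + t) by ring]
    exact (hmod α).add hαt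
  have hβe : β = e := by
    by_contra h
    refine ht _ (Finset.mem_union_right _ (Finset.mem_image_of_mem _
      (Finset.mem_erase.2 ⟨h, Finset.mem_range.2 hβ⟩))) b hb ?_
    rw [show (g' β * p' β + t : ℤ) = g' β * p' β - β + (β + t) by ring]
    exact (hmod' β).add hβt
  subst hα0 hβe
  refine hde (Int.natCast_dvd_natCast.1 ?_)
  have h1 := (Int.natCast_dvd_natCast.2 (Nat.gcd_dvd_left a b)).trans hαt
  have h2 := (Int.natCast_dvd_natCast.2 (Nat.gcd_dvd_right a b)).trans hβt
  have := h2.sub h1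
  simpa using this

theorem pairwise_coprime_of_Xeta_eq_XB {B : Set ℕ} (hB : ∀ b ∈ B, 2 ≤ b) (hprim : Primitive B)
    (heq : Xeta B = XB B) : B.Pairwise Nat.Coprime := by
  intro a ha b hb hab
  by_contra hd
  obtain ⟨q, hq, hqd⟩ := Nat.exists_prime_and_dvd hd
  wlog hle : b.factorization q ≤ a.factorization q generalizing a b
  · exact this hb ha hab.symm (fun h => hd h.symm) (Nat.gcd_comm a b ▸ hqd)
      (by omega)
  have ha0 : a ≠ 0 := by have := hB a ha; omega
  have hb0 : b ≠ 0 := by have := hB b hb; omega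
  have hnd : ¬ q ∣ ordCompl[q] b := Nat.not_dvd_ordCompl hq hb0
  refine hnd (hqd.trans (gcd_dvd_of_divisor hB hprim heq ha hb hab (Nat.ordCompl_dvd b q) ?_))
  intro hdvd
  refine hab (hprim b hb a ha ?_).symm
  rw [← Nat.ordProj_mul_ordCompl_eq_self b q]
  refine Nat.Coprime.mul_dvd_of_dvd_of_dvd ?_ ?_ hdvd
  · exact (Nat.coprime_ordCompl hq hb0).pow_left _
  · exact (pow_dvd_pow q hle).trans (Nat.ordProj_dvd a q)

/-- The finite set of those `i` with `n - ℓ ≤ i ≤ n + ℓ` at which `x` is `1`. -/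
noncomputable def windowSupp (x : ℤ → Bool) (n : ℤ) (ℓ : ℕ) : Finset ℤ :=
  (Finset.Icc (n - ℓ) (n + ℓ)).filter fun i => x i = true

theorem mem_windowSupp {x : ℤ → Bool} {n : ℤ} {ℓ : ℕ} {i : ℤ} :
    i ∈ windowSupp x n ℓ ↔ (n - ℓ ≤ i ∧ i ≤ n + ℓ) ∧ x i = true := by
  simp [windowSupp]

theorem isBAdmissible_windowSupp {B : Set ℕ} {x : ℤ → Bool} (hx : x ∈ XB B) (n : ℤ) (ℓ : ℕ) :
    IsBAdmissible B (windowSupp x n ℓ) :=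
  IsBAdmissible.mono hx fun _ hi => (mem_windowSupp.1 (Finset.mem_coe.1 hi)).2

theorem finIndicator_eq_of_mem_iff {A : Finset ℤ} {x : ℤ → Bool} {i : ℤ}
    (h : i ∈ A ↔ x i = true) : finIndicator A i = x i := by
  rw [Bool.eq_iff_iff, ← h]; simp [finIndicator]

section Code

variable {B : Set ℕ} {τ : (ℤ → Bool) → (ℤ → Bool)} {ℓ : ℕ}

theorem exists_residue_missed_by_image (hB : ∀ b ∈ B, 2 ≤ b) (hco : B.Pairwise Nat.Coprime)
    (hτ : IsCA (XB B) τ) (hcode : HasRadius (XB B) τ ℓ) {b : ℕ} (hb : b ∈ B) :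
    ∃ s : ℤ, ∀ x ∈ XB B, (∀ n, x n = true → ¬ (b : ℤ) ∣ n) →
      ∀ n, τ x n = true → ¬ (b : ℤ) ∣ n - s := by
  classical
  by_contra! H
  choose x hx hxb n hn hns using H
  have main : ∀ S : Finset ℕ, ∃ (A : Finset ℤ) (L : ℤ), IsBAdmissible B A ∧
      (∀ a ∈ A, ¬ (b : ℤ) ∣ a) ∧ (∀ a ∈ A, a ≤ L) ∧
      ∀ s ∈ S, ∃ k, k + ℓ ≤ L ∧ (b : ℤ) ∣ k - s ∧ τ (finIndicator A) k = true := by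
    intro S
    induction S using Finset.induction_on with
    | empty => exact ⟨∅, 0, isBAdmissible_of_card_le_one hB (by simp), by simp, by simp, by simp⟩
    | insert s S _ ih =>
      obtain ⟨A, L, hA, hAb, hAL, hAS⟩ := ih
      set W := windowSupp (x s) (n s) ℓ with hW
      have hWb : ∀ a ∈ W, ¬ (b : ℤ) ∣ a := fun a ha => hxb s a (mem_windowSupp.1 ha).2
      obtain ⟨m, hKm, hmb, hadm⟩ := exists_admissible_union hB hco hA
        (isBAdmissible_windowSupp (hx s) (n s) ℓ) (C := {b}) (by simpa using hb)
        (fun _ => 0) (fun _ => 0) (by simpa using hAb) (by simpa using hWb) (L + ℓ - n s)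
      replace hmb : (b : ℤ) ∣ m := by simpa using hmb
      have hWm : ∀ a, a ∈ W.image (· + m) ↔ a - m ∈ W := fun a => by
        simp only [Finset.mem_image]
        exact ⟨by rintro ⟨w, hw, rfl⟩; simpa using hw, fun h => ⟨_, h, by ring⟩⟩
      have hmem := finIndicator_mem_XB hadm
      refine ⟨_, m + n s + ℓ, hadm, fun a ha => ?_, fun a ha => ?_, fun r hr => ?_⟩
      · rcases Finset.mem_union.1 ha with ha | ha
        · exact hAb a ha
        · exact fun h => hWb _ ((hWm a).1 ha) (h.sub hmb)
      · rcases Finset.mem_union.1 ha with ha | ha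
        · have := hAL a ha; omega
        · have := (mem_windowSupp.1 ((hWm a).1 ha)).1; omega
      · rcases Finset.mem_insert.1 hr with rfl | hr
        · refine ⟨n r + m, by omega, ?_, ?_⟩
          · rw [show n r + m - r = n r - r + m by ring]
            exact (hns r).add hmb
          · rw [← hn r]
            have h1 := congrFun (hτ.shiftPow_comm hmem m) (n r)
            simp only [shiftPow] at h1
            rw [← h1]
            refine hcode _ (shiftPow_mem_XB hmem m) _ (hx r) _ fun i hi hi' => ?_
            rw [Bool.eq_iff_iff, shiftPow, finIndicator, decide_eq_true_iff, Finset.mem_union,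
              hWm, add_sub_cancel_right, hW, mem_windowSupp]
            refine ⟨fun h => h.elim (fun h => ?_) fun h => h.2, fun h => Or.inr ⟨⟨hi, hi'⟩, h⟩⟩
            have := hAL _ h
            omega
        · obtain ⟨k, hkL, hkr, hk⟩ := hAS r hr
          refine ⟨k, by omega, hkr, ?_⟩
          rw [← hk]
          refine hcode _ hmem _ (finIndicator_mem_XB hA) _ fun i hi hi' =>
            finIndicator_eq_of_mem_iff ?_
          rw [Finset.mem_union, hWm, finIndicator, decide_eq_true_iff]
          refine ⟨fun h => h.resolve_right fun h => ?_, Or.inl⟩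
          have := (mem_windowSupp.1 h).1
          omega
  obtain ⟨A, L, hA, -, -, hAS⟩ := main (Finset.range b)
  obtain ⟨r, hr⟩ := hτ.1 (finIndicator_mem_XB hA) b hb
  have hb2 := hB b hb
  have h0 := Int.emod_nonneg r (b := (b : ℤ)) (by omega)
  have h1 := Int.emod_lt_of_pos r (b := (b : ℤ)) (by omega)
  obtain ⟨k, -, hkr, hk⟩ := hAS (r % b).toNat (Finset.mem_range.2 (by omega))
  refine hr k hk ?_
  rw [Int.toNat_of_nonneg h0] at hkr
  rw [show k - r = k - r % b - (r - r % b) by ring]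
  exact hkr.sub Int.dvd_self_sub_emod

theorem exists_le_shiftPow (hB : ∀ b ∈ B, 2 ≤ b) (hco : B.Pairwise Nat.Coprime)
    (hinf : B.Infinite) (hτ : IsCA (XB B) τ) (hcode : HasRadius (XB B) τ ℓ)
    (hsurj : SurjOn τ (XB B) (XB B)) :
    ∃ t : ℤ, |t| ≤ ℓ ∧ ∀ x ∈ XB B, ∀ n, τ x n = true → x (n + t) = true := by
  obtain ⟨b, hb, hbℓ⟩ := hinf.exists_gt (2 * ℓ)
  obtain ⟨s, hs⟩ := exists_residue_missed_by_image hB hco hτ hcode hb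
  have hloc : ∀ x ∈ XB B, ∀ n, τ x n = true →
      ∃ j : ℤ, |j| ≤ ℓ ∧ (b : ℤ) ∣ j + s ∧ x (n + j) = true := by
    intro x hx n hn
    set W := windowSupp x n ℓ
    have hWmem := finIndicator_mem_XB (isBAdmissible_windowSupp hx n ℓ)
    have hτW : τ (finIndicator W) n = true := by
      rw [← hn]
      refine hcode _ hWmem _ hx _ fun i hi hi' => finIndicator_eq_of_mem_iff ?_
      rw [mem_windowSupp]
      exact ⟨fun h => h.2, fun h => ⟨⟨hi, hi'⟩, h⟩⟩
    by_contra! H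
    refine hs _ (shiftPow_mem_XB hWmem (n - s)) (fun k hk hd => ?_) s ?_ (by simp)
    · have hk' : k + (n - s) ∈ W := by simpa [shiftPow, finIndicator] using hk
      have h1 := mem_windowSupp.1 hk'
      refine H (k - s) (by rw [abs_le]; omega) (by simpa using hd) ?_
      rw [show n + (k - s) = k + (n - s) by ring]
      exact h1.2
    · rw [hτ.shiftPow_comm hWmem]
      simpa [shiftPow] using hτW
  obtain ⟨x, hx, hxu⟩ := hsurj (finIndicator_mem_XB
    (isBAdmissible_of_card_le_one hB (A := {0}) (by simp)))
  obtain ⟨t, ht, hts, -⟩ := hloc x hx 0 (by rw [hxu]; simp [finIndicator])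
  refine ⟨t, ht, fun y hy n hn => ?_⟩
  obtain ⟨j, hj, hjs, hyj⟩ := hloc y hy n hn
  have hd := hjs.sub hts
  rw [add_sub_add_right_eq_sub] at hd
  have : j - t = 0 := Int.eq_zero_of_abs_lt_dvd hd (by
    rw [abs_le] at ht hj; rw [abs_lt]; omega)
  rwa [show t = j by omega]

/-- A finite admissible set can be enlarged, away from a given bounded region, so that for the
finitely many `b ∈ C` it meets every residue class except the class of `γ b`. -/
theorem exists_admissible_superset_pinned (hB : ∀ b ∈ B, 2 ≤ b)
    (hco : B.Pairwise Nat.Coprime) {w : Finset ℤ} (hw : IsBAdmissible B w) {C : Finset ℕ}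
    (hC : (C : Set ℕ) ⊆ B) (γ : ℕ → ℤ) (hγ : ∀ b ∈ C, ∀ a ∈ w, ¬ (b : ℤ) ∣ a - γ b) (K : ℤ) :
    ∃ A : Finset ℤ, IsBAdmissible B A ∧ w ⊆ A ∧ (∀ a ∈ A, a ≤ K → a ∈ w) ∧
      ∀ b ∈ C, ∀ r : ℤ, (∀ a ∈ A, ¬ (b : ℤ) ∣ a - r) → (b : ℤ) ∣ r - γ b := by
  classical
  have main : ∀ S : Finset ((_ : ℕ) × ℕ), S ⊆ C.sigma Finset.range →
      ∃ A : Finset ℤ, IsBAdmissible B A ∧ w ⊆ A ∧ (∀ a ∈ A, a ≤ K → a ∈ w) ∧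
        (∀ b ∈ C, ∀ a ∈ A, ¬ (b : ℤ) ∣ a - γ b) ∧
        ∀ s ∈ S, (∀ a ∈ A, ¬ (s.1 : ℤ) ∣ a - s.2) → (s.1 : ℤ) ∣ s.2 - γ s.1 := by
    intro S
    induction S using Finset.induction_on with
    | empty => exact fun _ => ⟨w, hw, subset_rfl, fun a h _ => h, hγ, by simp⟩
    | insert s S _ ih =>
      intro hS
      obtain ⟨A, hA, hwA, hAK, hAγ, hAS⟩ := ih ((Finset.subset_insert _ _).trans hS)
      have hsC := Finset.mem_sigma.1 (hS (Finset.mem_insert_self _ _))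
      by_cases hsγ : (s.1 : ℤ) ∣ s.2 - γ s.1
      · refine ⟨A, hA, hwA, hAK, hAγ, fun r hr h => ?_⟩
        rcases Finset.mem_insert.1 hr with rfl | hr
        · exact hsγ
        · exact hAS r hr h
      set v : ℕ → ℤ := fun b => if b = s.1 then s.2 else γ b + 1 with hv
      have hvγ : ∀ b ∈ C, ¬ (b : ℤ) ∣ v b - γ b := by
        intro b hb
        by_cases hbs : b = s.1
        · subst hbs
          simpa [hv] using hsγ
        · simp only [hv, if_neg hbs, add_sub_cancel_left]
          intro h
          have := Int.le_of_dvd one_pos h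
          have := hB b (hC hb)
          omega
      obtain ⟨m, hKm, hm, hadm⟩ := exists_admissible_union hB hco hA (W := {0})
        (isBAdmissible_of_card_le_one hB (by simp)) hC γ v hAγ
        (fun b hb => by simpa using hvγ b hb) K
      rw [Finset.image_singleton, zero_add] at hadm
      refine ⟨_, hadm, hwA.trans Finset.subset_union_left, fun a ha haK => ?_,
        fun b hb a ha => ?_, fun r hr h => ?_⟩
      · rcases Finset.mem_union.1 ha with ha | ha
        · exact hAK a ha haK
        · rw [Finset.mem_singleton] at ha; omega
      · rcases Finset.mem_union.1 ha with ha | ha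
        · exact hAγ b hb a ha
        · rw [Finset.mem_singleton.1 ha]
          intro h
          refine hvγ b hb ?_
          rw [show v b - γ b = m - γ b - (m - v b) by ring]
          exact h.sub (hm b hb)
      · rcases Finset.mem_insert.1 hr with rfl | hr
        · refine absurd ?_ (h m (by simp))
          have := hm r.1 hsC.1
          simpa [hv] using this
        · exact hAS r hr fun a ha => h a (Finset.mem_union_left _ ha)
  obtain ⟨A, hA, hwA, hAK, -, hAS⟩ := main _ subset_rfl
  refine ⟨A, hA, hwA, hAK, fun b hb r hr => ?_⟩
  have hb2 := hB b (hC hb)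
  have h0 := Int.emod_nonneg r (b := (b : ℤ)) (by omega)
  have h1 := Int.emod_lt_of_pos r (b := (b : ℤ)) (by omega)
  have hd : (b : ℤ) ∣ r - r % b := Int.dvd_self_sub_emod
  have h2 := hAS ⟨b, (r % b).toNat⟩
    (Finset.mem_sigma.2 ⟨hb, Finset.mem_range.2 (by dsimp only; omega)⟩)
  simp only [Int.toNat_of_nonneg h0] at h2
  have h3 := h2 fun a ha h => hr a ha (by
    rw [show a - r = a - r % b - (r - r % b) by ring]; exact h.sub hd)
  rw [show r - γ b = r - r % b + (r % b - γ b) by ring]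
  exact hd.add h3

theorem shiftPow_le_of_surjOn (hB : ∀ b ∈ B, 2 ≤ b) (hco : B.Pairwise Nat.Coprime)
    (hinf : B.Infinite) (hcode : HasRadius (XB B) τ ℓ)
    (hsurj : SurjOn τ (XB B) (XB B)) {t : ℤ} (ht : |t| ≤ ℓ)
    (hle : ∀ x ∈ XB B, ∀ n, τ x n = true → x (n + t) = true) {x : ℤ → Bool} (hx : x ∈ XB B)
    (hxt : x t = true) : τ x 0 = true := by
  classical
  have hinf' : (B \ ((Finset.range (2 * ℓ + 1) : Finset ℕ) : Set ℕ)).Infinite :=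
    hinf.sdiff (Finset.finite_toSet _)
  set e := hinf'.natEmbedding
  have heB : ∀ k, (e k : ℕ) ∈ B := fun k => (e k).2.1
  have heℓ : ∀ k, 2 * ℓ < (e k : ℕ) := fun k => by
    have := (e k).2.2
    simp only [Finset.mem_coe, Finset.mem_range] at this
    omega
  set β : ℤ → ℕ := fun i => e (i + ℓ).toNat
  set Z : Finset ℤ := (Finset.Icc (-(ℓ : ℤ)) ℓ).filter fun i => x i = false with hZ
  have hZm : ∀ i ∈ Z, -(ℓ : ℤ) ≤ i ∧ i ≤ ℓ ∧ x i = false := fun i hi => by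
    simpa [hZ, and_assoc] using hi
  have hβinj : ∀ i ∈ Z, ∀ j ∈ Z, β i = β j → i = j := fun i hi j hj h => by
    have h1 := e.injective (Subtype.ext h)
    have h2 := hZm i hi
    have h3 := hZm j hj
    omega
  have hγ : ∃ γ : ℕ → ℤ, ∀ i ∈ Z, γ (β i) = i := by
    refine ⟨fun b => if h : ∃ i ∈ Z, β i = b then h.choose else 0, fun i hi => ?_⟩
    have h : ∃ j ∈ Z, β j = β i := ⟨i, hi, rfl⟩
    simp only [dif_pos h]
    exact hβinj _ h.choose_spec.1 _ hi h.choose_spec.2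
  obtain ⟨γ, hγ⟩ := hγ
  obtain ⟨A, hA, hwA, hAw, hpin⟩ := exists_admissible_superset_pinned hB hco
    (isBAdmissible_windowSupp hx 0 ℓ) (C := Z.image β)
    (fun b hb => by
      obtain ⟨i, -, rfl⟩ := Finset.mem_image.1 (Finset.mem_coe.1 hb)
      exact heB _)
    γ (fun b hb a ha hd => by
      obtain ⟨i, hi, rfl⟩ := Finset.mem_image.1 hb
      rw [hγ i hi] at hd
      have h1 := mem_windowSupp.1 ha
      have h2 := hZm i hi
      have h3 : 2 * ℓ < β i := heℓ _
      have h4 := Int.eq_zero_of_abs_lt_dvd hd (by rw [abs_lt]; omega)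
      have h5 : a = i := by omega
      subst h5
      simp_all) ℓ
  obtain ⟨y, hy, hτy⟩ := hsurj (shiftPow_mem_XB (finIndicator_mem_XB hA) t)
  have hAy : ∀ a ∈ A, y a = true := fun a ha => by
    have := hle y hy (a - t) (by rw [hτy]; simpa [shiftPow, finIndicator] using ha)
    simpa using this
  have hyx : ∀ i : ℤ, 0 - (ℓ : ℤ) ≤ i → i ≤ 0 + ℓ → x i = y i := by
    intro i hi hi'
    cases hxi : x i with
    | true => exact (hAy i (hwA (mem_windowSupp.2 ⟨⟨hi, hi'⟩, hxi⟩))).symm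
    | false =>
      have hiZ : i ∈ Z := by
        simp only [hZ, Finset.mem_filter, Finset.mem_Icc]
        exact ⟨⟨by omega, by omega⟩, hxi⟩
      obtain ⟨r, hr⟩ := hy (β i) (heB _)
      have h1 := hpin (β i) (Finset.mem_image_of_mem _ hiZ) r fun a ha => hr a (hAy a ha)
      rw [hγ i hiZ] at h1
      by_contra hyi
      refine hr i (by simpa [supp] using Ne.symm hyi) ?_
      rw [← neg_sub]
      exact h1.neg_right
  rw [hcode x hx y hy 0 hyx, hτy]
  rw [abs_le] at ht
  have : t ∈ A := hwA (mem_windowSupp.2 ⟨⟨by omega, by omega⟩, hxt⟩)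
  simpa [shiftPow, finIndicator] using this

theorem exists_eqOn_shiftPow (hB : ∀ b ∈ B, 2 ≤ b) (hco : B.Pairwise Nat.Coprime)
    (hinf : B.Infinite) (hτ : IsCA (XB B) τ) (hcode : HasRadius (XB B) τ ℓ)
    (hsurj : SurjOn τ (XB B) (XB B)) :
    ∃ t : ℤ, |t| ≤ (ℓ : ℤ) ∧ Set.EqOn τ (shiftPow t) (XB B) := by
  obtain ⟨t, ht, hle⟩ := exists_le_shiftPow hB hco hinf hτ hcode hsurj
  refine ⟨t, ht, fun x hx => funext fun n => ?_⟩
  rw [Bool.eq_iff_iff]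
  refine ⟨fun h => hle x hx n h, fun h => ?_⟩
  have h1 := shiftPow_le_of_surjOn hB hco hinf hcode hsurj ht hle
    (shiftPow_mem_XB hx n) (by simpa [shiftPow, add_comm] using h)
  rw [hτ.shiftPow_comm hx] at h1
  simpa [shiftPow] using h1

end Code

theorem IsCA.exists_hasRadius {B : Set ℕ} {σ : (ℤ → Bool) → (ℤ → Bool)}
    (hσ : IsCA (XB B) σ) (hcl : IsClosed (XB B)) : ∃ ℓ : ℕ, HasRadius (XB B) σ ℓ := by
  have hloc : ∀ x ∈ XB B, ∃ N : ℕ, ∀ y ∈ XB B,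
      (∀ i : ℤ, -(N : ℤ) ≤ i → i ≤ N → y i = x i) → σ y 0 = σ x 0 := by
    intro x hx
    have hcont : ContinuousWithinAt (fun y => σ y 0) (XB B) x :=
      (continuous_apply (0 : ℤ)).continuousAt.comp_continuousWithinAt (hσ.2.1 x hx)
    have hnhds := hcont.preimage_mem_nhdsWithin (t := {σ x 0}) (by simp)
    obtain ⟨u, hu, hxu, huX⟩ := mem_nhdsWithin.1 hnhds
    obtain ⟨I, v, hv, hIv⟩ := isOpen_pi_iff.1 hu x hxu
    refine ⟨I.sup Int.natAbs, fun y hy h => huX ⟨hIv fun i hi => ?_, hy⟩⟩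
    have := Finset.le_sup (f := Int.natAbs) (Finset.mem_coe.1 hi)
    rw [h i (by omega) (by omega)]
    exact (hv i hi).2
  choose! N hN using hloc
  obtain ⟨T, hT, hcov⟩ := hcl.isCompact.elim_nhds_subcover
    (fun x => Set.pi (Finset.Icc (-(N x : ℤ)) (N x) : Set ℤ) fun i => {x i}) fun x _ =>
      (isOpen_set_pi (Finset.finite_toSet _) fun _ _ => isOpen_discrete _).mem_nhds
        (by simp [Set.mem_pi])
  have hzero : ∀ x ∈ XB B, ∀ y ∈ XB B,
      (∀ i : ℤ, -((T.sup N : ℕ) : ℤ) ≤ i → i ≤ (T.sup N : ℕ) → x i = y i) →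
        σ x 0 = σ y 0 := by
    intro x hx y hy h
    obtain ⟨z, hz, hxz⟩ := Set.mem_iUnion₂.1 (hcov hx)
    have hxz' : ∀ i : ℤ, -(N z : ℤ) ≤ i → i ≤ N z → x i = z i := fun i hi hi' =>
      hxz i (by simp [hi, hi'])
    have hle := Finset.le_sup (f := N) hz
    rw [hN z (hT z hz) x hx hxz', hN z (hT z hz) y hy fun i hi hi' =>
      (h i (by omega) (by omega)).symm.trans (hxz' i hi hi')]
  refine ⟨T.sup N, fun x hx y hy n h => ?_⟩
  have h1 := hzero _ (shiftPow_mem_XB hx n) _ (shiftPow_mem_XB hy n) fun i hi hi' =>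
    h (i + n) (by omega) (by omega)
  rw [hσ.shiftPow_comm hx, hσ.shiftPow_comm hy] at h1
  simpa [shiftPow] using h1

/-- if `X_η = X_B`, then every surjective CA with a code of radius `ℓ` equals
`S^t` for some `|t| ≤ ℓ`; in particular the Moore property holds: every surjective CA is
pre-injective. -/
theorem surjective_ca_shift_power_of_eq_admissible (B : Set ℕ)
    (hBpos : ∀ b ∈ B, 2 ≤ b) (hBprim : Primitive B)
    (heq : Xeta B = XB B)
    (τ : (ℤ → Bool) → (ℤ → Bool)) (hτ : IsCA (Xeta B) τ)
    (ℓ : ℕ) (hcode : HasRadius (Xeta B) τ ℓ)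
    (hsurj : Set.SurjOn τ (Xeta B) (Xeta B)) :
    (∃ t : ℤ, |t| ≤ (ℓ : ℤ) ∧ Set.EqOn τ (shiftPow t) (Xeta B)) ∧
      (∀ σ : (ℤ → Bool) → (ℤ → Bool), IsCA (Xeta B) σ →
        Set.SurjOn σ (Xeta B) (Xeta B) → PreInjective (Xeta B) σ) := by
  have hinf := infinite_of_Xeta_eq_XB hBpos heq
  have hco := pairwise_coprime_of_Xeta_eq_XB hBpos hBprim heq
  have hcl : IsClosed (XB B) := heq ▸ isClosed_closure
  rw [heq] at *
  refine ⟨exists_eqOn_shiftPow hBpos hco hinf hτ hcode hsurj, fun σ hσ hσs x hx y hy hxy _ => ?_⟩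
  obtain ⟨N, hN⟩ := hσ.exists_hasRadius hcl
  obtain ⟨t, -, ht⟩ := exists_eqOn_shiftPow hBpos hco hinf hσ hN hσs
  rw [ht hx, ht hy] at hxy
  have h := congrArg (shiftPow (-t)) hxy
  simpa only [shiftPow_shiftPow, neg_add_cancel, shiftPow_zero] using h
end

section
/- Let X₀ ⊆ {0,1}^ℤ be a shift-invariant hereditary set all of whose elements differ from the all-zero sequence 0^ℤ in at most finitely many coordinates. Assume τ : X₀ → X₀ commutes with the shift, is monotone in the sense that τ(x) ≤ x coordinatewise for all x ∈ X₀, and is injective. Then τ is the identity map. -/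
open Filter Set

/-- a shift-commuting, monotone, injective map on a shift-invariant hereditary
set of finitely supported sequences is the identity. -/
theorem monotone_injective_is_identity (X₀ : Set (ℤ → Bool))
    (hinv : ∀ x : ℤ → Bool, x ∈ X₀ ↔ shift x ∈ X₀)
    (hfin : ∀ x ∈ X₀, {n : ℤ | x n ≠ false}.Finite)
    (hhered : Hereditary X₀)
    (τ : (ℤ → Bool) → (ℤ → Bool)) (hmaps : Set.MapsTo τ X₀ X₀)
    (hcomm : ∀ x ∈ X₀, τ (shift x) = shift (τ x))
    (hmono : ∀ x ∈ X₀, ∀ n : ℤ, τ x n ≤ x n)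
    (hinj : Set.InjOn τ X₀) :
    ∀ x ∈ X₀, τ x = x := by
  suffices h : ∀ k : ℕ, ∀ x ∈ X₀, {n : ℤ | x n ≠ false}.ncard = k → τ x = x from
    fun x hx => h _ x hx rfl
  intro k
  induction k using Nat.strong_induction_on with
  | _ k ih =>
    intro x hx hk
    by_contra hne
    have hsub : {n : ℤ | τ x n ≠ false} ⊂ {n : ℤ | x n ≠ false} := by
      refine ⟨fun n hn hxn => hn ?_, fun hle => hne ?_⟩
      · exact le_bot_iff.mp ((hmono x hx n).trans_eq hxn)
      · funext n
        have hn : x n ≠ false → τ x n ≠ false := fun h => hle h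
        have hm := hmono x hx n
        revert hn hm
        cases x n <;> cases τ x n <;> simp
    have hlt := Set.ncard_lt_ncard hsub (hfin x hx)
    exact hne (hinj (hmaps hx) hx (ih _ (hk ▸ hlt) (τ x) (hmaps hx) rfl))
end

section
/- Let (X, S) be a hereditary subshift and let τ be a pre-injective cellular automaton on (X, S). Then τ is bounded-to-one: there exists a finite constant C such that |τ^{-1}({y})| ≤ C for all y ∈ X. -/
open Filter Set

/-- A subshift is invariant under every integer power of the shift, and a CA commutes with it. -/
theorem IsCA.map_shiftPow {X : Set (ℤ → Bool)} (hX : IsSubshift X) {τ : (ℤ → Bool) → (ℤ → Bool)}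
    (hτ : IsCA X τ) (t : ℤ) {x : ℤ → Bool} (hx : x ∈ X) :
    shiftPow t x ∈ X ∧ τ (shiftPow t x) = shiftPow t (τ x) := by
  have shift_eq (x : ℤ → Bool) (t : ℤ) : shift (shiftPow t x) = shiftPow (t + 1) x := by
    funext n
    simp only [shift, shiftPow]
    congr 1
    ring
  induction t using Int.induction_on with
  | zero =>
    have h (z : ℤ → Bool) : shiftPow 0 z = z := by funext n; simp [shiftPow]
    simpa [h] using hx
  | succ i ih =>
    rw [← shift_eq, ← shift_eq, ← ih.2]
    exact ⟨hX.2.2 ▸ mem_image_of_mem shift ih.1, hτ.2.2 _ ih.1⟩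
  | pred i ih =>
    obtain ⟨z, hz, hzx⟩ : shiftPow (-i) x ∈ shift '' X := hX.2.2.symm ▸ ih.1
    have shift_injective : Function.Injective shift := by
      intro a b hab
      funext n
      simpa [shift, shiftPow] using congrFun hab (n - 1)
    have hz' : z = shiftPow (-i - 1) x := shift_injective (by rw [hzx, shift_eq]; congr 1; ring)
    rw [← hz']
    refine ⟨hz, shift_injective ?_⟩
    rw [← hτ.2.2 z hz, hzx, ih.2, shift_eq]
    congr 1
    ring

/-- Curtis–Hedlund–Lyndon: a CA on a subshift is given by a sliding block code. -/
theorem IsCA.exists_hasRadius_s9 {X : Set (ℤ → Bool)} (hX : IsSubshift X)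
    {τ : (ℤ → Bool) → (ℤ → Bool)} (hτ : IsCA X τ) : ∃ ℓ : ℕ, HasRadius X τ ℓ := by
  suffices h : ∃ ℓ : ℕ, ∀ x ∈ X, ∀ y ∈ X, (∀ i : ℤ, |i| ≤ ℓ → x i = y i) → τ x 0 = τ y 0 by
    obtain ⟨ℓ, h⟩ := h
    refine ⟨ℓ, fun x hx y hy n hxy => ?_⟩
    have hx' := hτ.map_shiftPow hX n hx
    have hy' := hτ.map_shiftPow hX n hy
    have := h _ hx'.1 _ hy'.1 fun i hi => hxy _ (by grind) (by grind)
    simpa [hx'.2, hy'.2, shiftPow] using this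
  by_contra! hcon
  let D : Set ((ℤ → Bool) × (ℤ → Bool)) := (X ×ˢ X) ∩ {p | τ p.1 0 ≠ τ p.2 0}
  let A : ℕ → Set ((ℤ → Bool) × (ℤ → Bool)) := fun ℓ => {p | ∀ i : ℤ, |i| ≤ ℓ → p.1 i = p.2 i}
  have hD : IsClosed D := by
    have hτ0 : ContinuousOn (fun x => τ x 0) X := (continuous_apply 0).comp_continuousOn hτ.2.1
    have hc : ContinuousOn (fun p : (ℤ → Bool) × (ℤ → Bool) => (τ p.1 0, τ p.2 0)) (X ×ˢ X) :=
      (hτ0.comp continuousOn_fst fun _ hp => hp.1).prodMk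
        (hτ0.comp continuousOn_snd fun _ hp => hp.2)
    exact hc.preimage_isClosed_of_isClosed (hX.2.1.prod hX.2.1)
      (isClosed_discrete {b : Bool × Bool | b.1 ≠ b.2})
  have hA (ℓ : ℕ) : IsClosed (A ℓ) := by
    simp only [A, ofPred_forall]
    exact isClosed_iInter fun i => isClosed_iInter fun _ =>
      isClosed_eq (by fun_prop) (by fun_prop)
  obtain ⟨p, hp⟩ := IsCompact.nonempty_iInter_of_sequence_nonempty_isCompact_isClosed
    (fun ℓ => D ∩ A ℓ)
    (fun ℓ p hp => ⟨hp.1, fun i hi => hp.2 i (hi.trans (by simp))⟩)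
    (fun ℓ => by
      obtain ⟨x, hx, y, hy, hxy, hne⟩ := hcon ℓ
      exact ⟨(x, y), ⟨⟨hx, hy⟩, hne⟩, hxy⟩)
    (hD.inter (hA 0)).isCompact (fun ℓ => hD.inter (hA ℓ))
  rw [mem_iInter] at hp
  have hpe : p.1 = p.2 := funext fun i => (hp i.natAbs).2 i (by simp)
  exact (hp 0).1.2 (by rw [hpe])

/-- Two points of a hereditary subshift with the same image under a pre-injective CA of radius `ℓ`
agree on `[-n, n]` as soon as they agree on the collars of width `2 * ℓ` around it. -/
theorem PreInjective.eq_of_eq_on_collar {X : Set (ℤ → Bool)} (hhered : Hereditary X)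
    {τ : (ℤ → Bool) → (ℤ → Bool)} {ℓ : ℕ} (hℓ : HasRadius X τ ℓ) (hpre : PreInjective X τ)
    {x y : ℤ → Bool} (hx : x ∈ X) (hy : y ∈ X) (hxy : τ x = τ y) (n : ℕ)
    (hcollar : ∀ i : ℤ, n < |i| → |i| ≤ n + 2 * ℓ → x i = y i) {i : ℤ} (hi : |i| ≤ n) :
    x i = y i := by
  let trunc (z : ℤ → Bool) : ℤ → Bool := fun i => if |i| ≤ n + 2 * ℓ then z i else false
  have trunc_of_le (z : ℤ → Bool) {i : ℤ} (hi : |i| ≤ n + 2 * ℓ) : trunc z i = z i := if_pos hi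
  have trunc_of_not_le (z : ℤ → Bool) {i : ℤ} (hi : ¬|i| ≤ n + 2 * ℓ) : trunc z i = false :=
    if_neg hi
  have trunc_mem {z : ℤ → Bool} (hz : z ∈ X) : trunc z ∈ X := by
    refine hhered z hz _ fun i => ?_
    by_cases hi : |i| ≤ n + 2 * ℓ
    · exact (trunc_of_le z hi).le
    · simp [trunc_of_not_le z hi]
  have trunc_eq {i : ℤ} (hi : n < |i|) : trunc x i = trunc y i := by
    by_cases hi' : |i| ≤ n + 2 * ℓ
    · rw [trunc_of_le x hi', trunc_of_le y hi', hcollar i hi hi']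
    · rw [trunc_of_not_le x hi', trunc_of_not_le y hi']
  have hτ : τ (trunc x) = τ (trunc y) := by
    funext m
    by_cases hm : |m| ≤ n + ℓ
    · have h {z : ℤ → Bool} (hz : z ∈ X) : τ (trunc z) m = τ z m :=
        hℓ _ (trunc_mem hz) _ hz m fun i _ _ => trunc_of_le z (by grind)
      rw [h hx, h hy, hxy]
    · exact hℓ _ (trunc_mem hx) _ (trunc_mem hy) m fun i _ _ => trunc_eq (by grind)
  have hfin : {i : ℤ | trunc x i ≠ trunc y i}.Finite := by
    refine (finite_Icc (-(n : ℤ)) n).subset fun i hi => abs_le.mp ?_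
    by_contra! h
    exact hi (trunc_eq h)
  have hle : |i| ≤ n + 2 * ℓ := by omega
  have := congrFun (hpre _ (trunc_mem hx) _ (trunc_mem hy) hτ hfin) i
  rwa [trunc_of_le x hle, trunc_of_le y hle] at this

/-- Finitely many sequences are distinguished by their restrictions to some window `[-n, n]`. -/
theorem exists_window_separating (s : Finset (ℤ → Bool)) :
    ∃ n : ℕ, ∀ x ∈ s, ∀ y ∈ s, (∀ i : ℤ, |i| ≤ n → x i = y i) → x = y := by
  have h (p : (ℤ → Bool) × (ℤ → Bool)) : ∃ i : ℤ, p.1 ≠ p.2 → p.1 i ≠ p.2 i := by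
    by_cases hp : p.1 = p.2
    · exact ⟨0, fun h => absurd hp h⟩
    · exact (Function.ne_iff.mp hp).imp fun _ hi _ => hi
  choose pos hpos using h
  refine ⟨(s ×ˢ s).sup fun p => (pos p).natAbs, fun x hx y hy hxy => ?_⟩
  by_contra hne
  refine hpos (x, y) hne (hxy _ ?_)
  rw [Int.abs_eq_natAbs]
  exact_mod_cast Finset.le_sup (f := fun p => (pos p).natAbs) (Finset.mk_mem_product hx hy)

/-- a pre-injective CA on a hereditary subshift is bounded-to-one. -/
theorem preinjective_bounded_to_one (X : Set (ℤ → Bool)) (hX : IsSubshift X)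
    (hhered : Hereditary X)
    (τ : (ℤ → Bool) → (ℤ → Bool)) (hτ : IsCA X τ) (hpre : PreInjective X τ) :
    ∃ C : ℕ, ∀ y ∈ X, {x ∈ X | τ x = y}.Finite ∧ {x ∈ X | τ x = y}.ncard ≤ C := by
  obtain ⟨ℓ, hℓ⟩ := hτ.exists_hasRadius_s9 hX
  have card_le (y : ℤ → Bool) (s : Finset (ℤ → Bool)) (hs : ↑s ⊆ {x ∈ X | τ x = y}) :
      s.card ≤ 2 ^ (2 * ℓ * 2) := by
    obtain ⟨n, hn⟩ := exists_window_separating s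
    let collar (x : ℤ → Bool) : Fin (2 * ℓ) × Bool → Bool :=
      fun k => x (if k.2 then n + 1 + k.1 else -(n + 1 + k.1))
    have hinj : Set.InjOn collar s := by
      intro x hx z hz hxz
      refine hn x hx z hz fun i hi => hpre.eq_of_eq_on_collar hhered hℓ (hs hx).1 (hs hz).1
        ((hs hx).2.trans (hs hz).2.symm) n (fun j hj hj' => ?_) hi
      have hk : |j| - (n + 1) = ((|j| - (n + 1)).toNat : ℤ) := by omega
      have hkey := congrFun hxz (⟨(|j| - (n + 1)).toNat, by omega⟩, decide (0 ≤ j))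
      have hpos : (if decide (0 ≤ j) = true then (n : ℤ) + 1 + ((|j| - (n + 1)).toNat : ℤ)
          else -(n + 1 + ((|j| - (n + 1)).toNat : ℤ))) = j := by
        rw [← hk]
        grind
      simp only [collar] at hkey
      rwa [hpos] at hkey
    simpa using Finset.card_le_card_of_injOn collar (t := Finset.univ)
      (fun _ _ => Finset.mem_coe.mpr (Finset.mem_univ _)) hinj
  refine ⟨2 ^ (2 * ℓ * 2), fun y _ => ?_⟩
  have hfin : {x ∈ X | τ x = y}.Finite := by
    by_contra hinf
    obtain ⟨s, hs, hcard⟩ := Set.Infinite.exists_subset_card_eq hinf (2 ^ (2 * ℓ * 2) + 1)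
    have := card_le y s hs
    omega
  refine ⟨hfin, ?_⟩
  rw [Set.ncard_eq_toFinset_card _ hfin]
  exact card_le y _ (by simp)
end
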